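/- There is no Tarski monster group of exponent $3$: there does not exist an infinite group $G$ with $x^3 = 1$ for all $x \in G$ such that every subgroup $H$ of $G$ with $H \neq \{1\}$ and $H \neq G$ has exactly $3$ elements. -/

import Mathlib

/-- In a group of exponent `3`, every element commutes with its conjugates. -/
theorem commute_conj_of_pow_three {G : Type*} [Group G] (h : ∀ x : G, x ^ 3 = 1) (x y : G) :
    Commute x (y * x * y⁻¹) := by
  have hy : y⁻¹ = y * y := by
    rw [inv_eq_iff_mul_eq_one, ← mul_assoc, ← pow_three', h]
  have h1 : y * x * y = x⁻¹ * y⁻¹ * x⁻¹ := by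
    have := h (x * y)
    calc y * x * y = x⁻¹ * (x * y) ^ 3 * y⁻¹ * x⁻¹ := by simp only [pow_succ]; group
      _ = _ := by rw [this]; group
  have h2 : y⁻¹ * x * y⁻¹ = x⁻¹ * y * x⁻¹ := by
    have := h (x * y⁻¹)
    calc y⁻¹ * x * y⁻¹ = x⁻¹ * (x * y⁻¹) ^ 3 * y * x⁻¹ := by simp only [pow_succ]; group
      _ = _ := by rw [this]; group
  have h3 : x * (y * x * y⁻¹) = y⁻¹ * x⁻¹ * y :=
    calc x * (y * x * y⁻¹) = x * (y * x * y) * y := by rw [hy]; group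
      _ = _ := by rw [h1]; group
  have hy' : y = y⁻¹ * y⁻¹ := by
    rw [eq_mul_inv_iff_mul_eq, ← hy]
  have h4 : (y * x * y⁻¹) * x = y⁻¹ * x⁻¹ * y :=
    calc (y * x * y⁻¹) * x = (y⁻¹ * y⁻¹) * x * y⁻¹ * x := by rw [← hy']
      _ = y⁻¹ * (y⁻¹ * x * y⁻¹) * x := by group
      _ = _ := by rw [h2]; group
  exact h3.trans h4.symm

/-- In an infinite torsion group all of whose proper nontrivial subgroups have the same prime
order `p`, every element commuting with some `x ≠ 1` is a power of `x`. -/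
theorem mem_zpowers_of_commute {G : Type*} [Group G] [Infinite G] {p : ℕ} (hp : p ≠ 0)
    (ht : ∀ x : G, x ^ p = 1) (hG : ∀ H : Subgroup G, H ≠ ⊥ → H ≠ ⊤ → Nat.card H = p)
    {x y : G} (hx : x ≠ 1) (hxy : Commute x y) : y ∈ Subgroup.zpowers x := by
  have hfin (z : G) : Finite (Subgroup.zpowers z) :=
    isOfFinOrder_iff_pow_eq_one.2 ⟨p, Nat.pos_of_ne_zero hp, ht z⟩ |>.finite_zpowers
  have := hfin x
  have := hfin y
  have hcard {H : Subgroup G} [Finite H] (hH : Subgroup.zpowers x ≤ H) : Nat.card H = p := by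
    apply hG
    · rintro rfl
      exact hx (Subgroup.mem_bot.1 (hH (Subgroup.mem_zpowers x)))
    · rintro rfl
      exact Set.infinite_univ (Set.toFinite ((⊤ : Subgroup G) : Set G))
  have hcomm (m : Subgroup.zpowers x) (n : Subgroup.zpowers y) :
      Commute ((Subgroup.zpowers x).subtype m) ((Subgroup.zpowers y).subtype n) := by
    obtain ⟨_, i, rfl⟩ := m
    obtain ⟨_, j, rfl⟩ := n
    exact hxy.zpow_zpow i j
  let f := (Subgroup.zpowers x).subtype.noncommCoprod (Subgroup.zpowers y).subtype hcomm
  have : Finite f.range := Set.finite_range f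
  have hle : Subgroup.zpowers x ≤ f.range := fun z hz => ⟨(⟨z, hz⟩, 1), by simp [f]⟩
  rw [Subgroup.eq_of_le_of_card_ge hle (by rw [hcard hle, hcard le_rfl])]
  exact ⟨(1, ⟨y, Subgroup.mem_zpowers y⟩), by simp [f]⟩

theorem stmt_6 :
    ¬ ∃ (G : Type) (_ : Group G), Infinite G ∧ (∀ x : G, x ^ 3 = 1) ∧
      ∀ H : Subgroup G, H ≠ ⊥ → H ≠ ⊤ → Nat.card H = 3 := by
  rintro ⟨G, _, _, h3, hG⟩
  obtain ⟨x, hx⟩ := exists_ne (1 : G)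
  have hfin : IsOfFinOrder x := isOfFinOrder_iff_pow_eq_one.2 ⟨3, by norm_num, h3 x⟩
  have hall (y : G) : y ∈ Subgroup.zpowers x := by
    refine mem_zpowers_of_commute (by norm_num) h3 hG hx ?_
    have hmem := mem_zpowers_of_commute (by norm_num) h3 hG hx (commute_conj_of_pow_three h3 x y)
    obtain ⟨n, hn : x ^ n = y * x * y⁻¹⟩ := hmem
    have hinv : x⁻¹ = x ^ 2 := by rw [inv_eq_iff_mul_eq_one, ← pow_succ', h3]
    have key : y * x * y⁻¹ = 1 ∨ y * x * y⁻¹ = x ∨ y * x * y⁻¹ = x⁻¹ := by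
      have hz : x ^ (3 : ℤ) = 1 := by exact_mod_cast h3 x
      rw [← hn, zpow_eq_zpow_emod n hz, hinv]
      have : n % 3 = 0 ∨ n % 3 = 1 ∨ n % 3 = 2 := by omega
      rcases this with h | h | h <;> rw [h]
      · simp
      · simp
      · exact Or.inr (Or.inr (zpow_ofNat x 2))
    rcases key with h | h | h
    · exact absurd (conj_eq_one_iff.1 h) hx
    · exact (mul_inv_eq_iff_eq_mul.1 h).symm
    · exfalso
      have hconj : y * x⁻¹ * y⁻¹ = x := by rw [← conj_inv, h, inv_inv]
      have : x = x⁻¹ :=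
        calc x = y ^ 3 * x * (y ^ 3)⁻¹ := by simp [h3]
          _ = y * (y * (y * x * y⁻¹) * y⁻¹) * y⁻¹ := by rw [pow_three]; group
          _ = x⁻¹ := by rw [h, hconj, h]
      apply hx
      have hh := h3 x
      rwa [pow_succ, ← hinv, ← this, ← sq, ← hinv, inv_eq_one] at hh
  have := hfin.finite_zpowers
  exact Set.infinite_univ (this.subset fun y _ => hall y)
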